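/- Let μ, ν ∈ P₁((0,∞)) with μ ≤_c ν, and assume S(ν) has finite second moment (equivalently, ∫ x⁻¹ dν(x) < ∞). Then sup{ ∫ x₀ · MCov(S(π_{x₀}), γ₁) dμ(x₀) : π ∈ M(μ,ν) } = b(μ) · sup{ ∫ MCov(π̃_{y₀}, γ₁) dS(μ)(y₀) : π̃ ∈ M(S(μ), S(ν)) }, and a coupling π ∈ M(μ,ν) attains the supremum on the left-hand side if and only if S(π) attains the supremum on the right-hand side. -/

import Mathlib

open MeasureTheory Set

/-- Barycenter of a measure on `ℝ`. -/
noncomputable def bary (mu : Measure ℝ) : ℝ := ∫ x, x ∂mu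

/-- `mu ∈ P₁((0,∞))`: Borel probability measure on `ℝ` concentrated on `(0,∞)`
with finite first moment. -/
def MemP1 (mu : Measure ℝ) : Prop :=
  IsProbabilityMeasure mu ∧ mu (Set.Ioi (0:ℝ))ᶜ = 0 ∧ Integrable id mu

/-- Change-of-numeraire transform of a measure on `ℝ`:
`S(mu)(B) = (1/b(mu)) ∫ x · 1_B(1/x) dmu(x)`. -/
noncomputable def S (mu : Measure ℝ) : Measure ℝ :=
  (ENNReal.ofReal (bary mu))⁻¹ •
    ((mu.withDensity fun x => ENNReal.ofReal x).map fun x => x⁻¹)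

/-- Change-of-numeraire transform of a measure on `ℝ × ℝ`:
`S(π)(B) = (∫ x₁ · 1_B(1/x₀,1/x₁) dπ) / (∫ x₁ dπ)`. -/
noncomputable def S2 (pi : Measure (ℝ × ℝ)) : Measure (ℝ × ℝ) :=
  (ENNReal.ofReal (∫ p, p.2 ∂pi))⁻¹ •
    ((pi.withDensity fun p => ENNReal.ofReal p.2).map fun p => (p.1⁻¹, p.2⁻¹))

/-- `π ∈ M(μ,ν)`: martingale coupling of `μ` and `ν`, i.e. a probability measure on
`(0,∞)²` with first marginal `μ`, second marginal `ν`, such that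
`∫ f(x₀)(x₁ - x₀) dπ = 0` for all bounded Borel `f`. -/
def IsMC (mu nu : Measure ℝ) (pi : Measure (ℝ × ℝ)) : Prop :=
  IsProbabilityMeasure pi ∧
  pi ((Set.Ioi (0:ℝ) ×ˢ Set.Ioi (0:ℝ))ᶜ) = 0 ∧
  pi.map Prod.fst = mu ∧ pi.map Prod.snd = nu ∧
  ∀ f : ℝ → ℝ, Measurable f → (∃ M, ∀ x, |f x| ≤ M) →
    ∫ p, f p.1 * (p.2 - p.1) ∂pi = 0

open scoped Classical in
/-- Disintegration (conditional kernel) of a measure on a product space with respect to the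
first coordinate; equal to `Measure.condKernel` for finite measures. -/
noncomputable def disint {α β : Type*} [MeasurableSpace α] [MeasurableSpace β]
    [StandardBorelSpace β] [Nonempty β] (rho : Measure (α × β)) : α → Measure β :=
  if h : IsFiniteMeasure rho then (letI := h; fun a => rho.condKernel a)
  else fun _ => 0


/-- Convex order: `∫ φ dμ ≤ ∫ φ dν` for every convex `φ` for which both integrals exist. -/
def ConvexOrder (mu nu : Measure ℝ) : Prop :=
  ∀ phi : ℝ → ℝ, ConvexOn ℝ Set.univ phi → Integrable phi mu → Integrable phi nu →
    ∫ x, phi x ∂mu ≤ ∫ x, phi x ∂nu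

/-- The standard Gaussian measure `γ₁` (mean 0, variance 1). -/
noncomputable def gauss1 : Measure ℝ := ProbabilityTheory.gaussianReal 0 1

/-- Maximal covariance `MCov(p₁,p₂) = sup { ∫ x·y dq : q coupling of p₁ and p₂ }`. -/
noncomputable def MCov (p1 p2 : Measure ℝ) : ℝ :=
  sSup {r | ∃ q : Measure (ℝ × ℝ), IsProbabilityMeasure q ∧
    q.map Prod.fst = p1 ∧ q.map Prod.snd = p2 ∧ r = ∫ p, p.1 * p.2 ∂q}

/-- The value `∫ x₀ · MCov(S(π_{x₀}), γ₁) dμ(x₀)`. -/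
noncomputable def valL (mu : Measure ℝ) (pi : Measure (ℝ × ℝ)) : ℝ :=
  ∫ x0, x0 * MCov (S (disint pi x0)) gauss1 ∂mu

/-- The value `∫ MCov(π̃_{y₀}, γ₁) dS(μ)(y₀)`. -/
noncomputable def valR (Smu : Measure ℝ) (rho : Measure (ℝ × ℝ)) : ℝ :=
  ∫ y0, MCov (disint rho y0) gauss1 ∂Smu

open ProbabilityTheory
open scoped ENNReal Pointwise

lemma lintegral_S (mu : Measure ℝ) {g : ℝ → ℝ≥0∞} (hg : Measurable g) :
    ∫⁻ y, g y ∂(S mu)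
      = (ENNReal.ofReal (bary mu))⁻¹ * ∫⁻ x, ENNReal.ofReal x * g x⁻¹ ∂mu := by
  rw [S, lintegral_smul_measure, lintegral_map hg measurable_inv,
    lintegral_withDensity_eq_lintegral_mul _ (by fun_prop) (by fun_prop)]
  rfl

lemma lintegral_S2 (pi : Measure (ℝ × ℝ)) {g : ℝ × ℝ → ℝ≥0∞} (hg : Measurable g) :
    ∫⁻ p, g p ∂(S2 pi)
      = (ENNReal.ofReal (∫ p, p.2 ∂pi))⁻¹ *
        ∫⁻ p, ENNReal.ofReal p.2 * g (p.1⁻¹, p.2⁻¹) ∂pi := by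
  rw [S2, lintegral_smul_measure, lintegral_map hg (by fun_prop),
    lintegral_withDensity_eq_lintegral_mul _ (by fun_prop) (by fun_prop)]
  rfl

lemma ae_S {mu : Measure ℝ} {P : ℝ → Prop} (h : ∀ᵐ x ∂mu, P x⁻¹) :
    ∀ᵐ y ∂(S mu), P y := by
  refine Measure.ae_smul_measure ?_ _
  rw [show (fun x : ℝ => x⁻¹) = MeasurableEquiv.inv ℝ from rfl,
    (MeasurableEquiv.inv ℝ).measurableEmbedding.ae_map_iff]
  exact (withDensity_absolutelyContinuous _ _).ae_le h

lemma ae_pos {mu : Measure ℝ} (h : mu (Ioi (0:ℝ))ᶜ = 0) : ∀ᵐ x ∂mu, 0 < x := h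

lemma integral_S {mu : Measure ℝ} (hpos : mu (Ioi (0:ℝ))ᶜ = 0) (hb : 0 ≤ bary mu) (g : ℝ → ℝ) :
    ∫ y, g y ∂(S mu) = (bary mu)⁻¹ * ∫ x, x * g x⁻¹ ∂mu := by
  rw [S, integral_smul_measure,
    show (fun x : ℝ => x⁻¹) = MeasurableEquiv.inv ℝ from rfl, integral_map_equiv,
    integral_withDensity_eq_integral_toReal_smul (by fun_prop) (by simp)]
  rw [ENNReal.toReal_inv, ENNReal.toReal_ofReal hb, smul_eq_mul]
  congr 1
  refine integral_congr_ae ?_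
  filter_upwards [ae_pos hpos] with x hx
  simp [ENNReal.toReal_ofReal hx.le]

lemma MemP1.bary_pos {mu : Measure ℝ} (h : MemP1 mu) : 0 < bary mu := by
  obtain ⟨h1, h2, h3⟩ := h
  have hp := ae_pos h2
  refine (integral_pos_iff_support_of_nonneg_ae (hp.mono fun x hx => hx.le) h3).2 ?_
  have : mu (Function.support fun x : ℝ => x) = mu univ :=
    measure_congr (by filter_upwards [hp] with x hx; simpa [Function.support] using ⟨fun _ => trivial, fun _ => hx.ne'⟩)
  rw [this]; simp

lemma MemP1.ofReal_bary {mu : Measure ℝ} (h : MemP1 mu) :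
    ENNReal.ofReal (bary mu) = ∫⁻ x, ENNReal.ofReal x ∂mu :=
  ofReal_integral_eq_lintegral_ofReal h.2.2 ((ae_pos h.2.1).mono fun _ hx => hx.le)

/-- The change of numeraire preserves the class of positive integrable laws. -/
lemma MemP1.S {mu : Measure ℝ} (h : MemP1 mu) : MemP1 (S mu) := by
  have hb : ENNReal.ofReal (bary mu) ≠ 0 := by simpa using h.bary_pos
  have := h.1
  have hpos : ∀ᵐ y ∂(_root_.S mu), 0 < y :=
    ae_S ((ae_pos h.2.1).mono fun x hx => inv_pos.2 hx)
  refine ⟨⟨?_⟩, hpos, ?_⟩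
  · rw [← lintegral_one, lintegral_S mu measurable_const]
    simp only [mul_one]
    rw [← h.ofReal_bary, ENNReal.inv_mul_cancel hb ENNReal.ofReal_ne_top]
  · change Integrable (fun y => y) _
    rw [← lintegral_ofReal_ne_top_iff_integrable (by fun_prop) (hpos.mono fun _ hx => hx.le)]
    rw [lintegral_S mu (by fun_prop)]
    refine ENNReal.mul_ne_top (ENNReal.inv_ne_top.2 hb) ?_
    rw [lintegral_congr_ae (g := fun _ => 1)]
    · simp
    · filter_upwards [ae_pos h.2.1] with x hx
      rw [← ENNReal.ofReal_mul hx.le, mul_inv_cancel₀ hx.ne', ENNReal.ofReal_one]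

lemma MemP1.bary_S {mu : Measure ℝ} (h : MemP1 mu) : bary (_root_.S mu) = (bary mu)⁻¹ := by
  have := h.1
  rw [bary, integral_S h.2.1 h.bary_pos.le, integral_congr_ae (g := fun _ => 1)]
  · simp
  · filter_upwards [ae_pos h.2.1] with x hx
    exact mul_inv_cancel₀ hx.ne'

lemma ofReal_mul_inv_mul {x : ℝ} (hx : 0 < x) (a : ℝ≥0∞) :
    ENNReal.ofReal x * (ENNReal.ofReal x⁻¹ * a) = a := by
  rw [← mul_assoc, ← ENNReal.ofReal_mul hx.le, mul_inv_cancel₀ hx.ne', ENNReal.ofReal_one, one_mul]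

lemma ofReal_inv_inv_mul_inv_mul {b : ℝ} (hb : 0 < b) (a : ℝ≥0∞) :
    (ENNReal.ofReal b⁻¹)⁻¹ * ((ENNReal.ofReal b)⁻¹ * a) = a := by
  rw [ENNReal.ofReal_inv_of_pos hb, inv_inv, ← mul_assoc,
    ENNReal.mul_inv_cancel (by simpa using hb) ENNReal.ofReal_ne_top, one_mul]

lemma MemP1.S_S {mu : Measure ℝ} (h : MemP1 mu) : _root_.S (_root_.S mu) = mu := by
  refine Measure.ext_of_lintegral _ fun g hg => ?_
  rw [lintegral_S _ hg, lintegral_S _ (by fun_prop), h.bary_S,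
    ofReal_inv_inv_mul_inv_mul h.bary_pos]
  refine lintegral_congr_ae ?_
  filter_upwards [ae_pos h.2.1] with x hx
  simp only [inv_inv, ofReal_mul_inv_mul hx]

section Coupling

variable {mu nu : Measure ℝ} {pi : Measure (ℝ × ℝ)}

lemma IsMC.ae_pos (h : IsMC mu nu pi) : ∀ᵐ p ∂pi, 0 < p.1 ∧ 0 < p.2 := h.2.1

lemma IsMC.integrable_fst (h : IsMC mu nu pi) (hmu : MemP1 mu) :
    Integrable (fun p : ℝ × ℝ => p.1) pi := by
  have := hmu.2.2
  rw [← h.2.2.1] at this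
  exact this.comp_measurable measurable_fst

lemma IsMC.integrable_snd (h : IsMC mu nu pi) (hnu : MemP1 nu) :
    Integrable (fun p : ℝ × ℝ => p.2) pi := by
  have := hnu.2.2
  rw [← h.2.2.2.1] at this
  exact this.comp_measurable measurable_snd

lemma IsMC.integral_snd (h : IsMC mu nu pi) : ∫ p, p.2 ∂pi = bary nu := by
  rw [bary, ← h.2.2.2.1, integral_map (by fun_prop) (by fun_prop)]

lemma IsMC.bary_eq (h : IsMC mu nu pi) (hmu : MemP1 mu) (hnu : MemP1 nu) :
    bary nu = bary mu := by
  have h1 := h.2.2.2.2 (fun _ => 1) measurable_const ⟨1, by simp⟩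
  simp only [one_mul] at h1
  rw [integral_sub (h.integrable_snd hnu) (h.integrable_fst hmu), h.integral_snd, sub_eq_zero] at h1
  rw [h1, bary, ← h.2.2.1, integral_map (by fun_prop) (by fun_prop)]

lemma IsMC.map_fst_withDensity (h : IsMC mu nu pi) (hmu : MemP1 mu) (hnu : MemP1 nu) :
    (pi.withDensity fun p => ENNReal.ofReal p.2).map Prod.fst
      = mu.withDensity fun x => ENNReal.ofReal x := by
  ext s hs
  have i1 := (h.integrable_fst hmu).integrableOn (s := Prod.fst ⁻¹' s)
  have i2 := (h.integrable_snd hnu).integrableOn (s := Prod.fst ⁻¹' s)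
  have hm : MeasurableSet (Prod.fst ⁻¹' s : Set (ℝ × ℝ)) := measurable_fst hs
  have key := h.2.2.2.2 (s.indicator fun _ => 1) (measurable_const.indicator hs)
    ⟨1, fun x => by by_cases hx : x ∈ s <;> simp [hx]⟩
  have e : (fun p : ℝ × ℝ => s.indicator (fun _ => (1:ℝ)) p.1 * (p.2 - p.1))
      = (Prod.fst ⁻¹' s).indicator fun p : ℝ × ℝ => p.2 - p.1 := by
    ext p; by_cases hp : p.1 ∈ s <;> simp [hp]
  rw [e, integral_indicator hm, integral_sub i2 i1, sub_eq_zero] at key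
  rw [Measure.map_apply measurable_fst hs, withDensity_apply _ hm, withDensity_apply _ hs,
    ← ofReal_integral_eq_lintegral_ofReal i2 (ae_restrict_of_ae (h.ae_pos.mono fun p hp => hp.2.le)),
    key, ofReal_integral_eq_lintegral_ofReal i1
      (ae_restrict_of_ae (h.ae_pos.mono fun p hp => hp.1.le)),
    ← h.2.2.1, setLIntegral_map hs (by fun_prop) measurable_fst]

lemma IsMC.lintegral_mul_snd (h : IsMC mu nu pi) (hmu : MemP1 mu) (hnu : MemP1 nu)
    {g : ℝ → ℝ≥0∞} (hg : Measurable g) :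
    ∫⁻ p, ENNReal.ofReal p.2 * g p.1 ∂pi = ∫⁻ x, ENNReal.ofReal x * g x ∂mu := by
  have := congrArg (fun m => ∫⁻ x, g x ∂m) (h.map_fst_withDensity hmu hnu)
  rw [lintegral_map hg measurable_fst,
    lintegral_withDensity_eq_lintegral_mul _ (by fun_prop) (by fun_prop),
    lintegral_withDensity_eq_lintegral_mul _ (by fun_prop) hg] at this
  exact this

lemma isMC_of_lintegral (hmu : MemP1 mu) (hnu : MemP1 nu) (h1 : IsProbabilityMeasure pi)
    (hpos : ∀ᵐ p ∂pi, 0 < p.1 ∧ 0 < p.2) (hfst : pi.map Prod.fst = mu)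
    (hsnd : pi.map Prod.snd = nu)
    (hg : ∀ g : ℝ → ℝ≥0∞, Measurable g →
      ∫⁻ p, ENNReal.ofReal p.2 * g p.1 ∂pi = ∫⁻ x, ENNReal.ofReal x * g x ∂mu) :
    IsMC mu nu pi := by
  refine ⟨h1, hpos, hfst, hsnd, fun f hf ⟨M, hM⟩ => ?_⟩
  have hmeas : (pi.withDensity fun p => ENNReal.ofReal p.2).map Prod.fst
      = mu.withDensity fun x => ENNReal.ofReal x := by
    refine Measure.ext_of_lintegral _ fun g hgm => ?_
    rw [lintegral_map hgm measurable_fst,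
      lintegral_withDensity_eq_lintegral_mul _ (by fun_prop) (by fun_prop),
      lintegral_withDensity_eq_lintegral_mul _ (by fun_prop) hgm]
    exact hg g hgm
  have i1 : Integrable (fun p : ℝ × ℝ => p.1) pi := by
    have := hmu.2.2
    rw [← hfst] at this
    exact this.comp_measurable measurable_fst
  have i2 : Integrable (fun p : ℝ × ℝ => p.2) pi := by
    have := hnu.2.2
    rw [← hsnd] at this
    exact this.comp_measurable measurable_snd
  have hfm : AEStronglyMeasurable (fun p : ℝ × ℝ => f p.1) pi :=
    (hf.comp measurable_fst).aestronglyMeasurable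
  have hfb : ∀ᵐ p : ℝ × ℝ ∂pi, ‖f p.1‖ ≤ M := Filter.Eventually.of_forall fun p => hM p.1
  have key := congrArg (fun m => ∫ x, f x ∂m) hmeas
  rw [integral_map (by fun_prop) hf.aestronglyMeasurable,
    integral_withDensity_eq_integral_toReal_smul (by fun_prop) (by simp),
    integral_withDensity_eq_integral_toReal_smul (by fun_prop) (by simp), ← hfst,
    integral_map (by fun_prop)
      ((by fun_prop : Measurable fun x : ℝ => (ENNReal.ofReal x).toReal • f x).aestronglyMeasurable)] at key
  simp only [mul_sub]
  rw [integral_sub (i2.bdd_mul hfm hfb) (i1.bdd_mul hfm hfb), sub_eq_zero]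
  convert key using 1 <;> refine integral_congr_ae ?_ <;> filter_upwards [hpos] with p hp
  · simp [ENNReal.toReal_ofReal hp.2.le, mul_comm]
  · simp [ENNReal.toReal_ofReal hp.1.le, mul_comm]

lemma ae_S2 {P : ℝ × ℝ → Prop} (hP : MeasurableSet {p | P p})
    (h : ∀ᵐ p ∂pi, P (p.1⁻¹, p.2⁻¹)) : ∀ᵐ p ∂(S2 pi), P p := by
  refine Measure.ae_smul_measure ?_ _
  rw [ae_map_iff (by fun_prop) hP]
  exact (withDensity_absolutelyContinuous _ _).ae_le h

/-- The change of numeraire maps martingale couplings to martingale couplings. -/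
lemma IsMC.S2 (h : IsMC mu nu pi) (hmu : MemP1 mu) (hnu : MemP1 nu) :
    IsMC (S mu) (S nu) (S2 pi) := by
  have hfst : (_root_.S2 pi).map Prod.fst = S mu := by
    refine Measure.ext_of_lintegral _ fun g hg => ?_
    rw [lintegral_map hg measurable_fst, lintegral_S2 _ (by fun_prop), lintegral_S _ hg,
      h.integral_snd, h.bary_eq hmu hnu,
      h.lintegral_mul_snd hmu hnu (g := fun x => g x⁻¹) (by fun_prop)]
  have hsnd : (_root_.S2 pi).map Prod.snd = S nu := by
    refine Measure.ext_of_lintegral _ fun g hg => ?_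
    rw [lintegral_map hg measurable_snd, lintegral_S2 _ (by fun_prop), lintegral_S _ hg,
      h.integral_snd, ← h.2.2.2.1, lintegral_map (by fun_prop) measurable_snd]
  refine isMC_of_lintegral hmu.S hnu.S ?_ ?_ hfst hsnd fun g hg => ?_
  · have := hmu.S.1
    rw [← hfst] at this
    exact Measure.isProbabilityMeasure_of_map Prod.fst
  · exact ae_S2 ((measurableSet_lt measurable_const measurable_fst).inter
      (measurableSet_lt measurable_const measurable_snd))
      (h.ae_pos.mono fun p hp => ⟨inv_pos.2 hp.1, inv_pos.2 hp.2⟩)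
  · rw [lintegral_S2 _ (by fun_prop), lintegral_S _ (by fun_prop), h.integral_snd,
      h.bary_eq hmu hnu, ← h.2.2.1, lintegral_map (by fun_prop) measurable_fst]
    congr 1
    refine lintegral_congr_ae ?_
    filter_upwards [h.ae_pos] with p hp
    simp only [ofReal_mul_inv_mul hp.1, ofReal_mul_inv_mul hp.2]

lemma IsMC.S2_S2 (h : IsMC mu nu pi) (hmu : MemP1 mu) (hnu : MemP1 nu) :
    _root_.S2 (_root_.S2 pi) = pi := by
  refine Measure.ext_of_lintegral _ fun g hg => ?_
  rw [lintegral_S2 _ hg, lintegral_S2 _ (by fun_prop), (h.S2 hmu hnu).integral_snd,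
    h.integral_snd, hnu.bary_S, ofReal_inv_inv_mul_inv_mul hnu.bary_pos]
  refine lintegral_congr_ae ?_
  filter_upwards [h.ae_pos] with p hp
  simp only [inv_inv, ofReal_mul_inv_mul hp.2]

lemma disint_eq_condKernel {α β : Type*} [MeasurableSpace α] [MeasurableSpace β]
    [StandardBorelSpace β] [Nonempty β] (rho : Measure (α × β)) [h : IsFiniteMeasure rho] (a : α) :
    disint rho a = rho.condKernel a := by
  simp [disint, h]

/-- An s-finite disintegration of a finite measure agrees almost everywhere with the
conditional kernel. -/
lemma ae_eq_condKernel_of_isSFiniteKernel {α β : Type*} [MeasurableSpace α] [MeasurableSpace β]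
    [StandardBorelSpace β] [Nonempty β] {rho : Measure (α × β)} [IsFiniteMeasure rho]
    (κ : Kernel α β) [IsSFiniteKernel κ] (hκ : rho = rho.fst ⊗ₘ κ) :
    ∀ᵐ x ∂rho.fst, κ x = rho.condKernel x := by
  have hA : MeasurableSet {x | κ x univ = 1} :=
    κ.measurable_coe MeasurableSet.univ (measurableSet_singleton 1)
  classical
  have hae : ∀ᵐ x ∂rho.fst, κ x univ = 1 := by
    filter_upwards [eq_condKernel_of_measure_eq_compProd' κ hκ MeasurableSet.univ] with x hx
    rw [hx, measure_univ]
  have : IsFiniteKernel (Kernel.piecewise hA κ rho.condKernel) := by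
    refine ⟨1, ENNReal.one_lt_top, fun x => ?_⟩
    rw [Kernel.piecewise_apply']
    split_ifs with hx
    · exact hx.le
    · exact prob_le_one
  have heq : κ =ᵐ[rho.fst] Kernel.piecewise hA κ rho.condKernel := by
    filter_upwards [hae] with x hx
    rw [Kernel.piecewise_apply, if_pos (show x ∈ {x | κ x univ = 1} from hx)]
  have key := eq_condKernel_of_measure_eq_compProd (ρ := rho)
    (Kernel.piecewise hA κ rho.condKernel) (by rwa [← Measure.compProd_congr heq])
  filter_upwards [heq, key] with x h1 h2
  rw [h1, h2]

lemma IsMC.lintegral_condKernel (h : IsMC mu nu pi) [IsFiniteMeasure pi]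
    {g : ℝ × ℝ → ℝ≥0∞} (hg : Measurable g) :
    ∫⁻ x, ∫⁻ y, g (x, y) ∂(pi.condKernel x) ∂mu = ∫⁻ p, g p ∂pi := by
  rw [← h.2.2.1]
  exact Measure.lintegral_condKernel hg

lemma IsMC.ae_lintegral_condKernel (h : IsMC mu nu pi) [IsFiniteMeasure pi] (hmu : MemP1 mu)
    (hnu : MemP1 nu) :
    ∀ᵐ x ∂mu, ∫⁻ y, ENNReal.ofReal y ∂(pi.condKernel x) = ENNReal.ofReal x := by
  have hm : Measurable fun x => ∫⁻ y, ENNReal.ofReal y ∂(pi.condKernel x) :=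
    Measurable.lintegral_kernel (by fun_prop)
  have := hmu.1
  refine (withDensity_eq_iff_of_sigmaFinite hm.aemeasurable (by fun_prop)).1 ?_
  refine Measure.ext_of_lintegral _ fun g hg => ?_
  rw [lintegral_withDensity_eq_lintegral_mul _ hm hg,
    lintegral_withDensity_eq_lintegral_mul _ (by fun_prop) hg]
  simp only [Pi.mul_apply]
  rw [← h.lintegral_mul_snd hmu hnu hg, ← h.lintegral_condKernel (by fun_prop)]
  refine lintegral_congr fun x => ?_
  exact (lintegral_mul_const _ (by fun_prop)).symm

lemma IsMC.ae_memP1_condKernel (h : IsMC mu nu pi) [IsFiniteMeasure pi] (hmu : MemP1 mu)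
    (hnu : MemP1 nu) :
    ∀ᵐ x ∂mu, MemP1 (pi.condKernel x) ∧ bary (pi.condKernel x) = x := by
  have hpos : ∀ᵐ x ∂mu, ∀ᵐ y ∂(pi.condKernel x), 0 < x ∧ 0 < y := by
    have := h.ae_pos
    rw [← pi.disintegrate pi.condKernel] at this
    have h2 := Measure.ae_ae_of_ae_compProd this
    rwa [Measure.fst, h.2.2.1] at h2
  filter_upwards [h.ae_lintegral_condKernel hmu hnu, hpos, _root_.ae_pos hmu.2.1] with x h1 h2 hx
  have hy : ∀ᵐ y ∂(pi.condKernel x), 0 < y := h2.mono fun _ hy => hy.2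
  have hM : MemP1 (pi.condKernel x) := by
    refine ⟨inferInstance, hy, ?_⟩
    change Integrable (fun y => y) _
    rw [← lintegral_ofReal_ne_top_iff_integrable (by fun_prop) (hy.mono fun _ hy => hy.le), h1]
    exact ENNReal.ofReal_ne_top
  refine ⟨hM, ?_⟩
  have := hM.ofReal_bary
  rwa [h1, ENNReal.ofReal_eq_ofReal_iff hM.bary_pos.le hx.le] at this

/-- The disintegration of the transform is the transform of the disintegration. -/
lemma IsMC.disint_S2 (h : IsMC mu nu pi) (hmu : MemP1 mu) (hnu : MemP1 nu) :
    ∀ᵐ y ∂(S mu), disint (_root_.S2 pi) y = S (disint pi y⁻¹) := by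
  have := h.1
  have h2 := h.S2 hmu hnu
  have := h2.1
  have hden : Measurable (Function.uncurry fun y x₁ : ℝ => ENNReal.ofReal y * ENNReal.ofReal x₁) := by
    unfold Function.uncurry; fun_prop
  let κ₀ : Kernel ℝ ℝ := pi.condKernel.comap (fun y => y⁻¹) measurable_inv
  let κ : Kernel ℝ ℝ :=
    (Kernel.withDensity κ₀ fun y x₁ => ENNReal.ofReal y * ENNReal.ofReal x₁).map fun x => x⁻¹
  have : IsSFiniteKernel (Kernel.withDensity κ₀ fun y x₁ : ℝ =>
      ENNReal.ofReal y * ENNReal.ofReal x₁) :=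
    Kernel.IsSFiniteKernel.withDensity _ fun _ _ =>
      ENNReal.mul_ne_top ENNReal.ofReal_ne_top ENNReal.ofReal_ne_top
  have hκint : ∀ y : ℝ, ∀ g : ℝ → ℝ≥0∞, Measurable g → ∫⁻ x, g x ∂(κ y)
      = ENNReal.ofReal y * ∫⁻ x, ENNReal.ofReal x * g x⁻¹ ∂(pi.condKernel y⁻¹) := by
    intro y g hg
    rw [Kernel.map_apply _ measurable_inv, lintegral_map hg measurable_inv,
      Kernel.lintegral_withDensity _ hden _ (by fun_prop), ← lintegral_const_mul _ (by fun_prop)]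
    simp only [mul_assoc]
    rfl
  have hκS : ∀ᵐ y ∂(S mu), κ y = S (pi.condKernel y⁻¹) := by
    refine ae_S ?_
    filter_upwards [h.ae_memP1_condKernel hmu hnu, _root_.ae_pos hmu.2.1] with x ⟨_, hx⟩ hx0
    refine Measure.ext_of_lintegral _ fun g hg => ?_
    rw [hκint _ _ hg, lintegral_S _ hg, inv_inv, hx, ENNReal.ofReal_inv_of_pos hx0]
  have hfst : (_root_.S2 pi).fst = S mu := h2.2.2.1
  have hdis : _root_.S2 pi = (_root_.S2 pi).fst ⊗ₘ κ := by
    refine Measure.ext_of_lintegral _ fun g hg => ?_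
    rw [Measure.lintegral_compProd hg, hfst, lintegral_S _ (by fun_prop), lintegral_S2 _ hg,
      h.integral_snd, h.bary_eq hmu hnu, ← h.lintegral_condKernel (by fun_prop)]
    congr 1
    refine lintegral_congr_ae ?_
    filter_upwards [_root_.ae_pos hmu.2.1] with x hx
    rw [hκint _ _ (by fun_prop), ofReal_mul_inv_mul hx, inv_inv]
  have key := ae_eq_condKernel_of_isSFiniteKernel κ hdis
  rw [hfst] at key
  filter_upwards [key, hκS] with y h3 h4
  rw [disint_eq_condKernel, disint_eq_condKernel, ← h3, h4]

lemma IsMC.valL_eq (h : IsMC mu nu pi) (hmu : MemP1 mu) (hnu : MemP1 nu) :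
    valL mu pi = bary mu * valR (S mu) (_root_.S2 pi) := by
  have e : valR (S mu) (_root_.S2 pi) = ∫ y, MCov (S (disint pi y⁻¹)) gauss1 ∂(S mu) := by
    refine integral_congr_ae ?_
    filter_upwards [h.disint_S2 hmu hnu] with y hy
    rw [hy]
  rw [e, integral_S hmu.2.1 hmu.bary_pos.le, mul_inv_cancel_left₀ hmu.bary_pos.ne']
  simp only [inv_inv, valL]

end Coupling

/-- the value of the gSBM weak transport problem equals `b(μ)` times the
value of the SBM weak transport problem between `S(μ)` and `S(ν)`, with `π` optimal iff
`S(π)` is optimal. -/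
theorem stmt11 (mu nu : Measure ℝ) (hmu : MemP1 mu) (hnu : MemP1 nu)
    (hcvx : ConvexOrder mu nu)
    (hmom2 : Integrable (fun x => x ^ 2) (S nu)) :
    sSup {r | ∃ pi, IsMC mu nu pi ∧ r = valL mu pi}
      = bary mu * sSup {r | ∃ rho, IsMC (S mu) (S nu) rho ∧ r = valR (S mu) rho} ∧
    ∀ pi, IsMC mu nu pi →
      ((valL mu pi = sSup {r | ∃ pi', IsMC mu nu pi' ∧ r = valL mu pi'}) ↔
       (valR (S mu) (S2 pi)
          = sSup {r | ∃ rho, IsMC (S mu) (S nu) rho ∧ r = valR (S mu) rho})) := by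
  have hset : {r | ∃ pi, IsMC mu nu pi ∧ r = valL mu pi}
      = bary mu • {r | ∃ rho, IsMC (S mu) (S nu) rho ∧ r = valR (S mu) rho} := by
    ext r
    rw [Set.mem_smul_set]
    constructor
    · rintro ⟨pi, hpi, rfl⟩
      exact ⟨_, ⟨S2 pi, hpi.S2 hmu hnu, rfl⟩, (hpi.valL_eq hmu hnu).symm⟩
    · rintro ⟨_, ⟨rho, hrho, rfl⟩, rfl⟩
      have hpi : IsMC mu nu (S2 rho) := by
        have := hrho.S2 hmu.S hnu.S
        rwa [hmu.S_S, hnu.S_S] at this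
      refine ⟨S2 rho, hpi, ?_⟩
      rw [hpi.valL_eq hmu hnu, hrho.S2_S2 hmu.S hnu.S, smul_eq_mul]
  have hsup : sSup {r | ∃ pi, IsMC mu nu pi ∧ r = valL mu pi}
      = bary mu * sSup {r | ∃ rho, IsMC (S mu) (S nu) rho ∧ r = valR (S mu) rho} := by
    rw [hset, Real.sSup_smul_of_nonneg hmu.bary_pos.le, smul_eq_mul]
  refine ⟨hsup, fun pi hpi => ?_⟩
  rw [hsup, hpi.valL_eq hmu hnu]
  exact mul_right_inj' hmu.bary_pos.ne'
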